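/- Let G = (σ, τ) be a grid diagram of size n, let r be a row with r+1 < n, and suppose the four columns σ(r), τ(r), σ(r+1), τ(r+1) are pairwise distinct and interleaved, i.e. exactly one of σ(r+1), τ(r+1) lies strictly between min(σ(r), τ(r)) and max(σ(r), τ(r)). Let G' = (σ∘t, τ∘t) with t the transposition (r, r+1) be the grid obtained by commuting rows r and r+1. Then |w(G') − w(G)| = 2: an interleaving row commutation realizes a single crossing change on the represented link, flipping the sign of exactly one crossing and changing the writhe by exactly ±2. -/

import Mathlib

/-- The set of crossings of the grid diagram `(σ, τ)`. -/
def crossings {n : ℕ} (σ τ : Equiv.Perm (Fin n)) : Finset (Fin n × Fin n) :=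
  Finset.univ.filter fun ij =>
    min (σ ij.1) (τ ij.1) < ij.2 ∧ ij.2 < max (σ ij.1) (τ ij.1) ∧
    min (σ⁻¹ ij.2) (τ⁻¹ ij.2) < ij.1 ∧ ij.1 < max (σ⁻¹ ij.2) (τ⁻¹ ij.2)

/-- The sign of the crossing `(i, j)`: `sgn((σ i − τ i) · (τ⁻¹ j − σ⁻¹ j))`. -/
def crossSign {n : ℕ} (σ τ : Equiv.Perm (Fin n)) (i j : Fin n) : ℤ :=
  Int.sign ((((σ i : ℕ) : ℤ) - ((τ i : ℕ) : ℤ)) * (((τ⁻¹ j : ℕ) : ℤ) - ((σ⁻¹ j : ℕ) : ℤ)))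

/-- The writhe of the grid diagram `(σ, τ)`: the sum of the signs of its crossings. -/
def writhe {n : ℕ} (σ τ : Equiv.Perm (Fin n)) : ℤ :=
  ∑ ij ∈ crossings σ τ, crossSign σ τ ij.1 ij.2


/-- Horizontal contribution: the sign of `p - q` if `j` is strictly between `p` and `q`. -/
def hPart (p q j : ℤ) : ℤ :=
  if (p < j ∧ j < q) then -1 else if (q < j ∧ j < p) then 1 else 0

/-- The row transposition on integers. -/
def tInt (r x : ℤ) : ℤ := if x = r then r + 1 else if x = r + 1 then r else x

set_option maxHeartbeats 2000000 in
theorem hPart_swap (r i a b : ℤ) (h1 : a ≠ b) (h2 : ¬ (a = r ∧ b = r + 1))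
    (h3 : ¬ (a = r + 1 ∧ b = r)) :
    hPart (tInt r b) (tInt r a) (tInt r i) - hPart b a i =
      (if i = r ∧ a = r + 1 then 1 else 0) - (if i = r ∧ b = r + 1 then 1 else 0)
      - (if i = r + 1 ∧ a = r then 1 else 0) + (if i = r + 1 ∧ b = r then 1 else 0) := by
  have ht : ∀ x, (x = r ∧ tInt r x = r + 1) ∨ (x = r + 1 ∧ tInt r x = r) ∨
      (x ≠ r ∧ x ≠ r + 1 ∧ tInt r x = x) := by
    intro x
    unfold tInt
    split_ifs <;> omega
  unfold hPart
  rcases ht i with ⟨hi, ei⟩ | ⟨hi, ei⟩ | ⟨hi, hi', ei⟩ <;>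
  rcases ht a with ⟨ha, ea⟩ | ⟨ha, ea⟩ | ⟨ha, ha', ea⟩ <;>
  rcases ht b with ⟨hb, eb⟩ | ⟨hb, eb⟩ | ⟨hb, hb', eb⟩ <;>
  rw [ei, ea, eb] <;> clear ht ei ea eb <;> split_ifs <;> omega

theorem hPart_interleave (a b c d : ℤ) (hab : a ≠ b) (hac : a ≠ c) (had : a ≠ d)
    (hbc : b ≠ c) (hbd : b ≠ d) (hcd : c ≠ d)
    (hint : Xor' (min a b < c ∧ c < max a b) (min a b < d ∧ d < max a b)) :
    |hPart a b c - hPart a b d - hPart c d a + hPart c d b| = 2 := by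
  have key : hPart a b c - hPart a b d - hPart c d a + hPart c d b = 2 ∨
      hPart a b c - hPart a b d - hPart c d a + hPart c d b = -2 := by
    unfold hPart
    rcases lt_or_gt_of_ne hab with h | h
    · rw [min_eq_left h.le, max_eq_right h.le] at hint
      rcases hint with ⟨hx, hy⟩ | ⟨hx, hy⟩ <;> split_ifs <;> omega
    · rw [min_eq_right h.le, max_eq_left h.le] at hint
      rcases hint with ⟨hx, hy⟩ | ⟨hx, hy⟩ <;> split_ifs <;> omega
  rcases key with h | h <;> rw [h] <;> rfl

theorem cross_term {n : ℕ} (σ τ : Equiv.Perm (Fin n)) (i j : Fin n) :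
    (if min (σ i) (τ i) < j ∧ j < max (σ i) (τ i) ∧
      min (σ⁻¹ j) (τ⁻¹ j) < i ∧ i < max (σ⁻¹ j) (τ⁻¹ j) then crossSign σ τ i j else 0) =
    hPart (σ i : ℕ) (τ i : ℕ) (j : ℕ) * hPart (τ⁻¹ j : ℕ) (σ⁻¹ j : ℕ) (i : ℕ) := by
  unfold crossSign
  rw [Int.sign_mul]
  generalize σ i = p
  generalize τ i = q
  generalize σ⁻¹ j = a
  generalize τ⁻¹ j = b
  have e : ∀ p q j : Fin n, hPart (p : ℕ) (q : ℕ) (j : ℕ) =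
      if min p q < j ∧ j < max p q then Int.sign (((p : ℕ) : ℤ) - ((q : ℕ) : ℤ)) else 0 := by
    intro p q j
    unfold hPart
    rcases lt_trichotomy p q with h | h | h
    · rw [min_eq_left h.le, max_eq_right h.le, Int.sign_eq_neg_one_of_neg (by omega)]
      split_ifs <;> omega
    · subst h
      simp
      omega
    · rw [min_eq_right h.le, max_eq_left h.le, Int.sign_eq_one_of_pos (by omega)]
      split_ifs <;> omega
  rw [e, e, min_comm b a, max_comm b a]
  split_ifs <;> first | tauto | simp

theorem writhe_eq {n : ℕ} (σ τ : Equiv.Perm (Fin n)) :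
    writhe σ τ = ∑ i : Fin n, ∑ j : Fin n,
      hPart (σ i : ℕ) (τ i : ℕ) (j : ℕ) * hPart (τ⁻¹ j : ℕ) (σ⁻¹ j : ℕ) (i : ℕ) := by
  unfold writhe crossings
  rw [Finset.sum_filter, Fintype.sum_prod_type]
  exact Finset.sum_congr rfl fun i _ => Finset.sum_congr rfl fun j _ => cross_term σ τ i j

theorem swap_tInt {n : ℕ} (r s x : Fin n) (hs : (s : ℕ) = (r : ℕ) + 1) :
    (((Equiv.swap r s x : Fin n) : ℕ) : ℤ) = tInt (r : ℕ) (x : ℕ) := by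
  unfold tInt
  rw [Equiv.swap_apply_def]
  split_ifs <;> omega

theorem sum_pick {n : ℕ} (f : Fin n → Fin n → ℤ) (r c : Fin n) :
    ∑ i, ∑ j, f i j * (if i = r ∧ j = c then 1 else 0) = f r c := by
  rw [Finset.sum_eq_single r, Finset.sum_eq_single c]
  · simp
  · intro j _ hj; simp [hj]
  · simp
  · intro i _ hi; simp [hi]
  · simp

theorem writhe_swap_sub {n : ℕ} (σ τ : Equiv.Perm (Fin n))
    (h : ∀ i, σ i ≠ τ i) (r s : Fin n) (hs : (s : ℕ) = (r : ℕ) + 1)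
    (h1 : σ r ≠ τ s) (h2 : σ s ≠ τ r) :
    writhe (σ * Equiv.swap r s) (τ * Equiv.swap r s) - writhe σ τ =
      hPart (σ r : ℕ) (τ r : ℕ) (σ s : ℕ) - hPart (σ r : ℕ) (τ r : ℕ) (τ s : ℕ)
      - hPart (σ s : ℕ) (τ s : ℕ) (σ r : ℕ) + hPart (σ s : ℕ) (τ s : ℕ) (τ r : ℕ) := by
  rw [writhe_eq, writhe_eq, ← Equiv.sum_comp (Equiv.swap r s)]
  simp only [mul_inv_rev, Equiv.Perm.mul_apply, Equiv.swap_inv, Equiv.swap_apply_self,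
    swap_tInt _ _ _ hs]
  rw [← sum_pick (fun i j : Fin n => hPart (σ i : ℕ) (τ i : ℕ) (j : ℕ)) r (σ s),
    ← sum_pick (fun i j : Fin n => hPart (σ i : ℕ) (τ i : ℕ) (j : ℕ)) r (τ s),
    ← sum_pick (fun i j : Fin n => hPart (σ i : ℕ) (τ i : ℕ) (j : ℕ)) s (σ r),
    ← sum_pick (fun i j : Fin n => hPart (σ i : ℕ) (τ i : ℕ) (j : ℕ)) s (τ r)]
  simp only [← Finset.sum_sub_distrib, ← Finset.sum_add_distrib]
  refine Finset.sum_congr rfl fun i _ => Finset.sum_congr rfl fun j _ => ?_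
  simp only [← mul_sub, ← mul_add]
  congr 1
  have ev : ∀ (ρ : Equiv.Perm (Fin n)) (x : Fin n), j = ρ x ↔ ρ⁻¹ j = x := by
    intro ρ x
    rw [Equiv.Perm.inv_eq_iff_eq]
  have er : ∀ x : Fin n, x = r ↔ (((x : ℕ) : ℤ) = ((r : ℕ) : ℤ)) := by
    intro x; omega
  have es : ∀ x : Fin n, x = s ↔ (((x : ℕ) : ℤ) = ((r : ℕ) : ℤ) + 1) := by
    intro x; omega
  have ha : σ (σ⁻¹ j) = j := by simp
  have hb : τ (τ⁻¹ j) = j := by simp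
  rw [hPart_swap]
  · simp only [ev, er, es]
  · intro e
    have e' : σ⁻¹ j = τ⁻¹ j := by omega
    exact h (σ⁻¹ j) (by rw [ha, e', hb])
  · rintro ⟨e, e'⟩
    rw [← er] at e
    rw [← es] at e'
    exact h1 (by rw [← e, ← e', ha, hb])
  · rintro ⟨e, e'⟩
    rw [← es] at e
    rw [← er] at e'
    exact h2 (by rw [← e, ← e', ha, hb])

/-- Let `(σ, τ)` be a grid diagram of size `n` and let `s = r + 1` be the
row above row `r`. Assume the four columns `σ r, τ r, σ s, τ s` are pairwise distinct and
interleaved: exactly one of `σ s, τ s` lies strictly between `min (σ r) (τ r)` and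
`max (σ r) (τ r)`. Then commuting rows `r` and `r+1` (passing to `(σ∘t, τ∘t)` with
`t = (r, r+1)`) changes the writhe by exactly `±2` (it realizes a single crossing change). -/
theorem interleaving_commutation_writhe (n : ℕ) (hn : 2 ≤ n) (σ τ : Equiv.Perm (Fin n))
    (h : ∀ i, σ i ≠ τ i) (r s : Fin n) (hs : (s : ℕ) = (r : ℕ) + 1)
    (hdist : ([σ r, τ r, σ s, τ s] : List (Fin n)).Pairwise (· ≠ ·))
    (hint : Xor'
      (min (σ r) (τ r) < σ s ∧ σ s < max (σ r) (τ r))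
      (min (σ r) (τ r) < τ s ∧ τ s < max (σ r) (τ r))) :
    |writhe (σ * Equiv.swap r s) (τ * Equiv.swap r s) - writhe σ τ| = 2 := by
  simp only [List.pairwise_cons, List.mem_cons, List.not_mem_nil, or_false, forall_eq_or_imp,
    forall_eq] at hdist
  obtain ⟨⟨hab, hac, had⟩, ⟨hbc, hbd⟩, hcd, -⟩ := hdist
  rw [writhe_swap_sub σ τ h r s hs had hbc.symm]
  apply hPart_interleave <;> try omega
  simp only [min_lt_iff, lt_max_iff, Fin.lt_def] at hint
  simp only [min_lt_iff, lt_max_iff, Nat.cast_lt]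
  exact hint
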